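/- arXiv:1807.01661 — 2 statements merged into one kernel-verified Lean document; each statement's English description precedes it below -/
import Mathlib

section
/- If Q is a probability mass function on W = {0,1}^4 satisfying the data-matching constraints sum_{w in W_x} Q(w) = P_{y,d|z} for each x = (y,d,z), then for any i in {0,1}, the probability that Y0 = i (i.e. sum of Q over w with y0 = i, summing over both values of y1) is at most P_{i,0|0} + P_{0,1|0} + P_{1,1|0}. -/
open Finset

abbrev W : Type := Fin 2 × Fin 2 × Fin 2 × Fin 2

/-- treatment received given instrument value z: d1 if z=1, d0 if z=0,
i.e. d = d1*z + d0*(1-z) for z ∈ {0,1}. -/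
def dsel (z : Fin 2) (w : W) : Fin 2 := if z = 1 then w.2.2.2 else w.2.2.1

/-- outcome given treatment d: y1 if d=1, y0 if d=0, i.e. y = y1*d + y0*(1-d). -/
def ysel (d : Fin 2) (w : W) : Fin 2 := if d = 1 then w.2.1 else w.1

/-- data-matching constraints: ∑_{w ∈ W_x} Q(w) = P_{y,d|z} for each x=(y,d,z). -/
def DataMatch (Q : W → ℝ) (P : Fin 2 → Fin 2 → Fin 2 → ℝ) : Prop :=
  ∀ y d z : Fin 2,
    ∑ w : W, (if dsel z w = d ∧ ysel d w = y then Q w else 0) = P y d z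

/-- Q is a probability mass function on W. -/
def IsPMF (Q : W → ℝ) : Prop := (∀ w : W, 0 ≤ Q w) ∧ ∑ w : W, Q w = 1

/-- P is a valid conditional distribution of (Y,D) given Z. -/
def PValid (P : Fin 2 → Fin 2 → Fin 2 → ℝ) : Prop :=
  (∀ y d z : Fin 2, 0 ≤ P y d z) ∧ ∀ z : Fin 2, ∑ y : Fin 2, ∑ d : Fin 2, P y d z = 1

/-- instrument monotonicity: no defiers, Q(y0,y1,1,0) = 0. -/
def Mono (Q : W → ℝ) : Prop := ∀ y0 y1 : Fin 2, Q (y0, y1, 1, 0) = 0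

theorem stmt_1 (P : Fin 2 → Fin 2 → Fin 2 → ℝ) (Q : W → ℝ)
    (hP : PValid P) (hQ : IsPMF Q) (hD : DataMatch Q P) (i : Fin 2) :
    ∑ w : W, (if w.1 = i then Q w else 0) ≤ P i 0 0 + P 0 1 0 + P 1 1 0 := by
  rw [← hD i 0 0, ← hD 0 1 0, ← hD 1 1 0, ← Finset.sum_add_distrib, ← Finset.sum_add_distrib]
  apply Finset.sum_le_sum
  rintro ⟨a, b, c, d⟩ -
  have h := hQ.1 (a, b, c, d)
  fin_cases b <;> fin_cases c <;> simp [dsel, ysel] at h ⊢ <;> split_ifs <;> linarith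
end

section
/- If Q is a probability mass function on W = {0,1}^4 satisfying the data-matching constraints and the monotonicity constraint Q(y0,y1,1,0)=0, then for any i,j in {0,1}: Prob{(Y0,Y1)=(1-i,1-j)} >= 1 - min{1, P_{i,0|0} + P_{1-i,0|1} + P_{1-j,1|0} + P_{j,1|1}}, i.e. 1 - P_{i,0|0} - P_{1-i,0|1} - P_{1-j,1|0} - P_{j,1|1} <= sum of Q over w with (y0,y1)=(1-i,1-j). -/
open Finset

theorem stmt_14 (P : Fin 2 → Fin 2 → Fin 2 → ℝ) (Q : W → ℝ)
    (hP : PValid P) (hQ : IsPMF Q) (hD : DataMatch Q P) (hM : Mono Q) (i j : Fin 2) :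
    1 - min 1 (P i 0 0 + P (1 - i) 0 1 + P (1 - j) 1 0 + P j 1 1) ≤
      ∑ w : W, (if w.1 = 1 - i ∧ w.2.1 = 1 - j then Q w else 0) := by
  obtain ⟨hQ0, hQ1⟩ := hQ
  rw [← hD i 0 0, ← hD (1 - i) 0 1, ← hD (1 - j) 1 0, ← hD j 1 1]
  have key : ∀ w : W, Q w ≤ (if dsel 0 w = 0 ∧ ysel 0 w = i then Q w else 0)
      + (if dsel 1 w = 0 ∧ ysel 0 w = 1 - i then Q w else 0)
      + (if dsel 0 w = 1 ∧ ysel 1 w = 1 - j then Q w else 0)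
      + (if dsel 1 w = 1 ∧ ysel 1 w = j then Q w else 0)
      + (if w.1 = 1 - i ∧ w.2.1 = 1 - j then Q w else 0) := by
    rintro ⟨a, b, c, d⟩
    have h0 := hQ0 (a, b, c, d)
    have hm := hM a b
    fin_cases i <;> fin_cases j <;> fin_cases a <;> fin_cases b <;> fin_cases c <;>
      fin_cases d <;> simp [dsel, ysel] at h0 hm ⊢ <;> linarith
  have hsum := Finset.sum_le_sum (fun w (_ : w ∈ (Finset.univ : Finset W)) => key w)
  simp only [Finset.sum_add_distrib] at hsum
  rw [hQ1] at hsum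
  have hnn : 0 ≤ ∑ w : W, (if w.1 = 1 - i ∧ w.2.1 = 1 - j then Q w else 0) :=
    Finset.sum_nonneg (fun w _ => by split_ifs <;> simp [hQ0 w])
  rw [sub_le_comm]
  apply le_min <;> linarith
end
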